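/- Let (X, d) be a metric space, A ⊆ X, and let (xₙ)_{n≥1} be a sequence of points of A converging to a point y ∈ A. Then d̃(x₁, y, A) ≤ Σ_{n=1}^{∞} d̃(xₙ, xₙ₊₁, A) (as elements of [0, ∞]); in particular, if the series on the right converges, then d̃(x₁, y, A) < ∞. -/

import Mathlib

open scoped ENNReal

/-- `chainDistEps A x y ε` is the infimum over all finite chains `x = x₀, x₁, …, x_k = y`
of points of `A` with consecutive distances `< ε` of the sum `∑ dist (xᵢ) (xᵢ₊₁)`
(`∞` if no such chain exists). -/
noncomputable def chainDistEps {X : Type*} [MetricSpace X] (A : Set X) (x y : X) (ε : ℝ) :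
    ℝ≥0∞ :=
  ⨅ (k : ℕ) (c : Fin (k + 1) → X) (_ : c 0 = x) (_ : c (Fin.last k) = y)
    (_ : ∀ i, c i ∈ A) (_ : ∀ i : Fin k, dist (c i.castSucc) (c i.succ) < ε),
    ∑ i : Fin k, ENNReal.ofReal (dist (c i.castSucc) (c i.succ))

/-- `chainDist A x y` is `d̃(x,y,A)`, the limit of `chainDistEps A x y ε` as `ε → 0⁺`;
since `ε ↦ chainDistEps A x y ε` is antitone in `ε`, this limit equals the supremum
over `ε > 0`. -/
noncomputable def chainDist {X : Type*} [MetricSpace X] (A : Set X) (x y : X) : ℝ≥0∞ :=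
  ⨆ (ε : ℝ) (_ : 0 < ε), chainDistEps A x y ε

section ChainDistEps

variable {X : Type*} [MetricSpace X] {A : Set X} {ε : ℝ}

theorem chainDistEps_le_sum {k : ℕ} (c : Fin (k + 1) → X) (hA : ∀ i, c i ∈ A)
    (hc : ∀ i : Fin k, dist (c i.castSucc) (c i.succ) < ε) :
    chainDistEps A (c 0) (c (Fin.last k)) ε ≤
      ∑ i : Fin k, ENNReal.ofReal (dist (c i.castSucc) (c i.succ)) :=
  iInf_le_of_le k <| iInf_le_of_le c <| iInf_le_of_le rfl <| iInf_le_of_le rfl <|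
    iInf_le_of_le hA <| iInf_le_of_le hc le_rfl

theorem chainDistEps_self {x : X} (hx : x ∈ A) : chainDistEps A x x ε = 0 := by
  simpa using chainDistEps_le_sum (k := 0) (ε := ε) (fun _ => x) (fun _ => hx) (fun i => i.elim0)

theorem chainDistEps_le_dist_add {x z w : X} (hx : x ∈ A) (hxz : dist x z < ε) :
    chainDistEps A x w ε ≤ ENNReal.ofReal (dist x z) + chainDistEps A z w ε := by
  rw [← tsub_le_iff_left]
  refine le_iInf fun k => le_iInf fun c => le_iInf fun h0 => le_iInf fun hl => le_iInf fun hA =>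
    le_iInf fun hc => tsub_le_iff_left.2 ?_
  subst h0 hl
  have h := chainDistEps_le_sum (A := A) (ε := ε) (Fin.cons x c : Fin (k + 2) → X)
    (Fin.cases hx hA) (Fin.cases hxz hc)
  rwa [Fin.sum_univ_succ] at h

theorem chainDistEps_le_sum_add {w : X} {k : ℕ} (c : Fin (k + 1) → X) (hA : ∀ i, c i ∈ A)
    (hc : ∀ i : Fin k, dist (c i.castSucc) (c i.succ) < ε) :
    chainDistEps A (c 0) w ε ≤
      ∑ i : Fin k, ENNReal.ofReal (dist (c i.castSucc) (c i.succ)) +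
        chainDistEps A (c (Fin.last k)) w ε := by
  induction k with
  | zero => simp
  | succ k ih =>
    rw [Fin.sum_univ_succ, add_assoc (ENNReal.ofReal _)]
    refine (chainDistEps_le_dist_add (hA 0) (hc 0)).trans ?_
    exact add_le_add le_rfl (ih (fun i => c i.succ) (fun i => hA _) (fun i => hc i.succ))

theorem chainDistEps_triangle (x z w : X) :
    chainDistEps A x w ε ≤ chainDistEps A x z ε + chainDistEps A z w ε := by
  rw [← tsub_le_iff_right]
  refine le_iInf fun k => le_iInf fun c => le_iInf fun h0 => le_iInf fun hl => le_iInf fun hA =>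
    le_iInf fun hc => ?_
  subst h0 hl
  exact tsub_le_iff_right.2 (chainDistEps_le_sum_add c hA hc)

theorem chainDistEps_le_dist {x z : X} (hx : x ∈ A) (hz : z ∈ A) (hxz : dist x z < ε) :
    chainDistEps A x z ε ≤ ENNReal.ofReal (dist x z) := by
  simpa [chainDistEps_self hz] using chainDistEps_le_dist_add (w := z) hx hxz

theorem chainDistEps_le_sum_range (x : ℕ → X) (hx : ∀ n, x n ∈ A) (n : ℕ) :
    chainDistEps A (x 0) (x n) ε ≤
      ∑ i ∈ Finset.range n, chainDistEps A (x i) (x (i + 1)) ε := by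
  induction n with
  | zero => simp [chainDistEps_self (hx 0)]
  | succ n ih =>
    rw [Finset.sum_range_succ]
    exact (chainDistEps_triangle _ (x n) _).trans (by gcongr)

theorem chainDistEps_le_chainDist (x z : X) (hε : 0 < ε) :
    chainDistEps A x z ε ≤ chainDist A x z :=
  le_iSup₂_of_le ε hε le_rfl

end ChainDistEps

/-- If `(xₙ)` is a sequence of points of `A` converging to `y ∈ A`, then
`d̃(x₀, y, A) ≤ ∑ₙ d̃(xₙ, xₙ₊₁, A)`; in particular, if the series on the right is finite,
so is the left-hand side. -/
theorem chainDist_le_tsum {X : Type*} [MetricSpace X] (A : Set X) (x : ℕ → X) (y : X)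
    (hx : ∀ n, x n ∈ A) (hy : y ∈ A) (hconv : Filter.Tendsto x Filter.atTop (nhds y)) :
    chainDist A (x 0) y ≤ ∑' n : ℕ, chainDist A (x n) (x (n + 1)) := by
  refine iSup₂_le fun ε hε => ?_
  have hdist : Filter.Tendsto (fun n => dist (x n) y) Filter.atTop (nhds 0) :=
    tendsto_iff_dist_tendsto_zero.1 hconv
  have hlim : Filter.Tendsto
      (fun n => ∑' n : ℕ, chainDist A (x n) (x (n + 1)) + ENNReal.ofReal (dist (x n) y))
      Filter.atTop (nhds (∑' n : ℕ, chainDist A (x n) (x (n + 1)))) := by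
    simpa using tendsto_const_nhds.add (ENNReal.tendsto_ofReal hdist)
  refine ge_of_tendsto hlim ?_
  filter_upwards [hdist.eventually_lt_const hε] with n hn
  refine (chainDistEps_triangle _ (x n) _).trans
    (add_le_add ?_ (chainDistEps_le_dist (hx n) hy hn))
  calc chainDistEps A (x 0) (x n) ε
      ≤ ∑ i ∈ Finset.range n, chainDistEps A (x i) (x (i + 1)) ε :=
        chainDistEps_le_sum_range x hx n
    _ ≤ ∑ i ∈ Finset.range n, chainDist A (x i) (x (i + 1)) :=
        Finset.sum_le_sum fun i _ => chainDistEps_le_chainDist _ _ hε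
    _ ≤ ∑' i : ℕ, chainDist A (x i) (x (i + 1)) := ENNReal.sum_le_tsum _
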